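/- Suppose that either (a) A₀ has an eigenvalue μ with Re μ > 0, or (b) there exist k ∈ {1, …, n}, reals ω, φ₁, …, φ_{k−1}, ψ, and γ > 0 such that χ_k(ω, φ₁, …, φ_{k−1}; e^{−σ_k γ − iψ}) = 0 and the polynomial Y ↦ χ_k(ω, φ₁, …, φ_{k−1}; Y) is not identically zero. Then there exists ε₀ > 0 such that for every 0 < ε < ε₀ there exists λ ∈ ℂ with χ^ε(λ) = 0 and Re λ > 0. -/

import Mathlib

open Matrix Complex

/-- Characteristic function χ^ε(λ) = det(−λI + A₀ + Σ_{k=1}^{n} A_k exp(−λ σ_k ε^{−k})). -/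
noncomputable def chiFn (d n : ℕ) (A : ℕ → Matrix (Fin d) (Fin d) ℂ) (σ : ℕ → ℝ)
    (ε : ℝ) (z : ℂ) : ℂ :=
  Matrix.det (-z • (1 : Matrix (Fin d) (Fin d) ℂ) + A 0 +
    ∑ k ∈ Finset.Icc 1 n, Complex.exp (-z * (σ k : ℂ) * (((ε⁻¹ : ℝ) : ℂ))^k) • A k)

/-- Truncated characteristic function
χ_k(ω, φ₁, …, φ_{k−1}; Y) = det(−iωI + A₀ + Σ_{j=1}^{k−1} A_j e^{−iσ_j φ_j} + A_k Y). -/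
noncomputable def chiTrunc (d : ℕ) (A : ℕ → Matrix (Fin d) (Fin d) ℂ) (σ : ℕ → ℝ)
    (k : ℕ) (ω : ℝ) (φ : ℕ → ℝ) (Y : ℂ) : ℂ :=
  Matrix.det ((-(ω : ℂ) * Complex.I) • (1 : Matrix (Fin d) (Fin d) ℂ) + A 0 +
    ∑ j ∈ Finset.Icc 1 (k - 1), Complex.exp (-Complex.I * (σ j : ℂ) * (φ j : ℂ)) • A j +
    Y • A k)

open Filter Topology

theorem Matrix.differentiable_det_of_entries {d : ℕ} {M : ℂ → Matrix (Fin d) (Fin d) ℂ}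
    (hM : ∀ i j, Differentiable ℂ fun z => M z i j) :
    Differentiable ℂ fun z => (M z).det := by
  simp only [Matrix.det_apply]
  refine Differentiable.fun_sum fun τ _ => ?_
  refine Differentiable.const_smul ?_ _
  exact Differentiable.fun_finsetProd fun i _ => hM _ _

/-- A form of Hurwitz's theorem: zeros of a nonzero entire limit persist along the family. -/
theorem eventually_exists_zero_of_tendsto {ι : Type*} {l : Filter ι} {F : ι → ℂ → ℂ} {G : ℂ → ℂ}
    {U : Set ℂ} {z₀ : ℂ} (hU : U ∈ 𝓝 z₀) (hF : ∀ i, Differentiable ℂ (F i))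
    (hG : Differentiable ℂ G) (h0 : G z₀ = 0) (hne : ∃ w, G w ≠ 0)
    (hlim : ∀ z ∈ U, Tendsto (fun p : ι × ℂ => F p.1 p.2) (l ×ˢ 𝓝 z) (𝓝 (G z))) :
    ∀ᶠ i in l, ∃ z ∈ U, F i z = 0 := by
  have hiso : ∀ᶠ z in 𝓝[≠] z₀, G z ≠ 0 := by
    refine (hG.analyticAt z₀).eventually_eq_zero_or_eventually_ne_zero.resolve_left fun h => ?_
    obtain ⟨w, hw⟩ := hne
    have hGan : AnalyticOnNhd ℂ G Set.univ := fun z _ => hG.analyticAt z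
    exact hw (hGan.eqOn_zero_of_preconnected_of_eventuallyEq_zero isPreconnected_univ
      (Set.mem_univ z₀) h (Set.mem_univ w))
  obtain ⟨r, hr, hball⟩ := Metric.nhds_basis_closedBall.mem_iff.1
    (inter_mem hU (eventually_nhdsWithin_iff.1 hiso))
  obtain ⟨m, hm, hGm⟩ : ∃ m > 0, ∀ z ∈ Metric.sphere z₀ r, m ≤ ‖G z‖ := by
    have hne' : (Metric.sphere z₀ r).Nonempty := NormedSpace.sphere_nonempty.2 hr.le
    obtain ⟨z, hz, hmin⟩ := (isCompact_sphere z₀ r).exists_isMinOn hne'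
      (hG.continuous.norm.continuousOn)
    refine ⟨‖G z‖, norm_pos_iff.2 ?_, fun y hy => hmin hy⟩
    exact (hball (Metric.sphere_subset_closedBall hz)).2 (Metric.ne_of_mem_sphere hz hr.ne')
  have hunif : TendstoUniformlyOn F G l (Metric.closedBall z₀ r) := by
    rw [← tendstoLocallyUniformlyOn_iff_tendstoUniformlyOn_of_compact
      (isCompact_closedBall z₀ r), tendstoLocallyUniformlyOn_iff_forall_tendsto]
    intro z hz
    have hz' : l ×ˢ 𝓝[Metric.closedBall z₀ r] z ≤ l ×ˢ 𝓝 z :=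
      Filter.prod_mono le_rfl nhdsWithin_le_nhds
    have h1 : Tendsto (fun p : ι × ℂ => G p.2) (l ×ˢ 𝓝 z) (𝓝 (G z)) :=
      (hG.continuous.tendsto z).comp tendsto_snd
    exact ((h1.prodMk_nhds (hlim z (hball hz).1)).mono_left hz').mono_right
      (nhds_le_uniformity (G z))
  filter_upwards [Metric.tendstoUniformlyOn_iff.1 hunif (m / 8) (by positivity)] with i hi
  have hi0 : ‖F i z₀‖ < m / 8 := by
    simpa [h0, dist_eq_norm] using hi z₀ (Metric.mem_closedBall_self hr.le)
  have hsphere : ∀ z ∈ Metric.sphere z₀ r, m / 2 ≤ ‖F i z - F i z₀‖ := by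
    intro z hz
    have h1 := hi z (Metric.sphere_subset_closedBall hz)
    have h2 := hGm z hz
    rw [dist_eq_norm] at h1
    have h3 := norm_sub_norm_le (G z) (G z - F i z)
    have h4 := norm_sub_norm_le (F i z) (F i z₀)
    rw [sub_sub_cancel] at h3
    linarith
  have hfreq : ∃ᶠ z in 𝓝 z₀, F i z ≠ F i z₀ := by
    intro h
    obtain ⟨y, hy⟩ : (Metric.sphere z₀ r).Nonempty := NormedSpace.sphere_nonempty.2 hr.le
    have han : AnalyticOnNhd ℂ (F i) Set.univ := fun z _ => (hF i).analyticAt z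
    have heq : F i y = F i z₀ := han.eqOn_of_preconnected_of_eventuallyEq
      (fun z _ => analyticAt_const) isPreconnected_univ (Set.mem_univ z₀)
      (by filter_upwards [h] with z hz using not_not.1 hz) (Set.mem_univ y)
    have := hsphere y hy
    rw [heq, sub_self, norm_zero] at this
    linarith
  obtain ⟨z, hz, hFz⟩ := (hF i).diffContOnCl.ball_subset_image_closedBall hr hsphere hfreq
    (show (0 : ℂ) ∈ Metric.ball (F i z₀) (m / 2 / 2) by
      rw [mem_ball_iff_norm, zero_sub, norm_neg]; linarith)
  exact ⟨z, (hball hz).1, hFz⟩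

theorem differentiable_chiFn (d n : ℕ) (A : ℕ → Matrix (Fin d) (Fin d) ℂ) (σ : ℕ → ℝ) (ε : ℝ) :
    Differentiable ℂ (chiFn d n A σ ε) := by
  unfold chiFn
  refine Matrix.differentiable_det_of_entries fun i j => ?_
  simp only [Matrix.add_apply, Matrix.smul_apply, Matrix.sum_apply, smul_eq_mul]
  fun_prop

theorem differentiable_chiTrunc (d : ℕ) (A : ℕ → Matrix (Fin d) (Fin d) ℂ) (σ : ℕ → ℝ)
    (k : ℕ) (ω : ℝ) (φ : ℕ → ℝ) : Differentiable ℂ (chiTrunc d A σ k ω φ) := by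
  unfold chiTrunc
  refine Matrix.differentiable_det_of_entries fun i j => ?_
  simp only [Matrix.add_apply, Matrix.smul_apply, smul_eq_mul]
  fun_prop

theorem tendsto_inv_pow_nhdsGT_zero {j : ℕ} (hj : j ≠ 0) :
    Tendsto (fun ε : ℝ => (ε⁻¹) ^ j) (𝓝[>] 0) atTop :=
  (tendsto_pow_atTop hj).comp tendsto_inv_nhdsGT_zero

theorem pow_mul_inv_pow_of_le {ε : ℝ} (hε : ε ≠ 0) {j k : ℕ} (h : j ≤ k) :
    ε ^ k * (ε⁻¹) ^ j = ε ^ (k - j) := by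
  rw [inv_pow, ← div_eq_mul_inv, pow_sub₀ _ hε h, div_eq_mul_inv]

theorem pow_mul_inv_pow_of_ge {ε : ℝ} (hε : ε ≠ 0) {j k : ℕ} (h : k ≤ j) :
    ε ^ k * (ε⁻¹) ^ j = (ε⁻¹) ^ (j - k) := by
  rw [pow_sub₀ _ (inv_ne_zero hε) h, inv_pow ε k, inv_inv, mul_comm]

theorem tendsto_pow_nhdsGT_zero {j : ℕ} (hj : j ≠ 0) :
    Tendsto (fun ε : ℝ => ε ^ j) (𝓝[>] 0) (𝓝 0) := by
  simpa [hj] using ((continuous_pow j).tendsto (0 : ℝ)).mono_left nhdsWithin_le_nhds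

/-- Frequencies converging to `ω` can be chosen so that all the rescaled phases converge. -/
theorem exists_frequency_tendsto (σ : ℕ → ℝ) (θ : ℕ → ℝ) (ω : ℝ) (k : ℕ)
    (hσ : ∀ j, 1 ≤ j → j ≤ k → 0 < σ j) :
    ∃ w : ℝ → ℝ, Tendsto w (𝓝[>] 0) (𝓝 ω) ∧ ∀ j, 1 ≤ j → j ≤ k →
      Tendsto (fun ε : ℝ => Complex.exp (-((w ε * σ j * (ε⁻¹) ^ j : ℝ) : ℂ) * I)) (𝓝[>] 0)
        (𝓝 (Complex.exp (-(θ j : ℂ) * I))) := by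
  induction k with
  | zero => exact ⟨fun _ => ω, tendsto_const_nhds, fun j h1 h2 => by omega⟩
  | succ k ih =>
    obtain ⟨w, hw, hph⟩ := ih fun j h1 h2 => hσ j h1 (h2.trans k.le_succ)
    have hs : 0 < σ (k + 1) := hσ (k + 1) (by omega) le_rfl
    set p : ℝ → ℝ := fun ε => θ (k + 1) - w ε * σ (k + 1) * (ε⁻¹) ^ (k + 1)
    set c : ℝ → ℝ := fun ε => toIcoMod Real.two_pi_pos 0 (p ε) / σ (k + 1) with hc
    have hcb : ∀ ε, |c ε| ≤ 2 * Real.pi / σ (k + 1) := by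
      intro ε
      have h1 := toIcoMod_mem_Ico Real.two_pi_pos 0 (p ε)
      rw [hc, abs_of_nonneg (div_nonneg h1.1 hs.le)]
      have h2 := h1.2.le
      rw [zero_add] at h2
      gcongr
    have hsmall : ∀ m, m ≠ 0 → Tendsto (fun ε : ℝ => ε ^ m * c ε) (𝓝[>] 0) (𝓝 0) := fun m hm =>
      (tendsto_pow_nhdsGT_zero hm).zero_mul_isBoundedUnder_le
        (isBoundedUnder_of ⟨_, hcb⟩)
    refine ⟨fun ε => w ε + ε ^ (k + 1) * c ε, by simpa using hw.add (hsmall (k + 1) (by omega)),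
      fun j h1 h2 => ?_⟩
    rcases h2.lt_or_eq with h2 | rfl
    · have h3 : Tendsto (fun ε : ℝ =>
          Complex.exp (-((σ j * (ε ^ (k + 1 - j) * c ε) : ℝ) : ℂ) * I)) (𝓝[>] 0) (𝓝 1) := by
        have hcont : Continuous fun x : ℝ => Complex.exp (-((σ j * x : ℝ) : ℂ) * I) := by fun_prop
        have := (hcont.tendsto 0).comp (hsmall (k + 1 - j) (by omega))
        simpa [Function.comp_def] using this
      have h4 := (hph j h1 (by omega)).mul h3
      rw [mul_one] at h4
      refine h4.congr' ?_
      filter_upwards [self_mem_nhdsWithin] with ε hε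
      rw [← Complex.exp_add, ← pow_mul_inv_pow_of_le (ne_of_gt hε) h2.le]
      congr 1
      push_cast
      ring
    · refine tendsto_const_nhds.congr' ?_
      filter_upwards [self_mem_nhdsWithin] with ε hε
      have hval : (w ε + ε ^ (k + 1) * c ε) * σ (k + 1) * (ε⁻¹) ^ (k + 1) =
          θ (k + 1) - toIcoDiv Real.two_pi_pos 0 (p ε) * (2 * Real.pi) := by
        have h5 := self_sub_toIcoDiv_zsmul Real.two_pi_pos 0 (p ε)
        have h6 : ε ^ (k + 1) * (ε⁻¹) ^ (k + 1) = 1 := by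
          rw [← mul_pow, mul_inv_cancel₀ (ne_of_gt hε), one_pow]
        have h7 : c ε * σ (k + 1) = toIcoMod Real.two_pi_pos 0 (p ε) :=
          div_mul_cancel₀ _ hs.ne'
        rw [zsmul_eq_mul] at h5
        have h8 : p ε = θ (k + 1) - w ε * σ (k + 1) * (ε⁻¹) ^ (k + 1) := rfl
        linear_combination c ε * σ (k + 1) * h6 + h7 - h5 + h8
      rw [hval, Complex.exp_eq_exp_iff_exists_int]
      refine ⟨-toIcoDiv Real.two_pi_pos 0 (p ε), ?_⟩
      push_cast
      ring

theorem tendsto_exp_delay_zero {s : ℝ} (hs : 0 < s) {j : ℕ} (hj : j ≠ 0) {z : ℂ} (hz : 0 < z.re) :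
    Tendsto (fun p : ℝ × ℂ => Complex.exp (-p.2 * (s : ℂ) * ((p.1⁻¹ : ℝ) : ℂ) ^ j))
      (𝓝[>] 0 ×ˢ 𝓝 z) (𝓝 0) := by
  rw [tendsto_zero_iff_norm_tendsto_zero]
  have hre : ∀ p : ℝ × ℂ, ‖Complex.exp (-p.2 * (s : ℂ) * ((p.1⁻¹ : ℝ) : ℂ) ^ j)‖ =
      Real.exp (-(p.2.re * s * (p.1⁻¹) ^ j)) := by
    intro p
    rw [Complex.norm_exp, ← Complex.ofReal_pow, Complex.re_mul_ofReal, Complex.re_mul_ofReal]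
    simp
  simp only [hre]
  refine Real.tendsto_exp_neg_atTop_nhds_zero.comp ?_
  refine Tendsto.pos_mul_atTop (mul_pos hz hs) ?_
    ((tendsto_inv_pow_nhdsGT_zero hj).comp tendsto_fst)
  exact ((Complex.continuous_re.tendsto z).comp tendsto_snd).mul_const s

theorem Matrix.exists_det_neg_smul_one_add_ne_zero {d : ℕ} (M : Matrix (Fin d) (Fin d) ℂ) :
    ∃ w : ℂ, (-w • (1 : Matrix (Fin d) (Fin d) ℂ) + M).det ≠ 0 := by
  by_contra! h
  refine M.charpoly_monic.ne_zero (Polynomial.funext fun w => ?_)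
  rw [Matrix.eval_charpoly, Polynomial.eval_zero]
  have h1 : Matrix.scalar (Fin d) w - M = -(-w • (1 : Matrix (Fin d) (Fin d) ℂ) + M) := by
    rw [Matrix.scalar_apply, ← Matrix.smul_one_eq_diagonal]
    simp [sub_eq_add_neg, add_comm]
  rw [h1, Matrix.det_neg, h w, mul_zero]

theorem eventually_chiFn_zero_of_instantaneous (d n : ℕ)
    (A : ℕ → Matrix (Fin d) (Fin d) ℂ) (σ : ℕ → ℝ) (hσ : ∀ k, 1 ≤ k → k ≤ n → 0 < σ k) {μ : ℂ}
    (hμ : Matrix.det (-μ • (1 : Matrix (Fin d) (Fin d) ℂ) + A 0) = 0) (hre : 0 < μ.re) :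
    ∀ᶠ ε in 𝓝[>] (0 : ℝ), ∃ z : ℂ, 0 < z.re ∧ chiFn d n A σ ε z = 0 := by
  refine eventually_exists_zero_of_tendsto (U := {z : ℂ | 0 < z.re})
    (G := fun z => Matrix.det (-z • (1 : Matrix (Fin d) (Fin d) ℂ) + A 0))
    ((isOpen_lt continuous_const Complex.continuous_re).mem_nhds hre)
    (differentiable_chiFn d n A σ) ?_ hμ (Matrix.exists_det_neg_smul_one_add_ne_zero (A 0)) ?_
  · refine Matrix.differentiable_det_of_entries fun i j => ?_
    simp only [Matrix.add_apply, Matrix.smul_apply, smul_eq_mul]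
    fun_prop
  · intro z hz
    unfold chiFn
    refine ((continuous_id.matrix_det).tendsto _).comp ?_
    have hsum : Tendsto (fun p : ℝ × ℂ => ∑ k ∈ Finset.Icc 1 n,
        Complex.exp (-p.2 * (σ k : ℂ) * (((p.1⁻¹ : ℝ) : ℂ)) ^ k) • A k)
        (𝓝[>] 0 ×ˢ 𝓝 z) (𝓝 (∑ k ∈ Finset.Icc 1 n, (0 : ℂ) • A k)) := by
      refine tendsto_finsetSum _ fun k hk => ?_
      rw [Finset.mem_Icc] at hk
      exact (tendsto_exp_delay_zero (hσ k hk.1 hk.2) (by omega) hz).smul_const _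
    simp only [zero_smul, Finset.sum_const_zero] at hsum
    have hlin : Tendsto (fun p : ℝ × ℂ => -p.2 • (1 : Matrix (Fin d) (Fin d) ℂ) + A 0)
        (𝓝[>] 0 ×ˢ 𝓝 z) (𝓝 (-z • (1 : Matrix (Fin d) (Fin d) ℂ) + A 0)) :=
      (tendsto_snd.neg.smul_const _).add_const _
    simpa using hlin.add hsum

/-- The limits of the delay factors at `i w(ε) + ε ^ k z`. -/
theorem tendsto_exp_delay_rescaled {s : ℝ} (hs : 0 < s) {w : ℝ → ℝ} {j k : ℕ} {θ : ℝ}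
    (hw : j ≤ k → Tendsto (fun ε : ℝ => Complex.exp (-((w ε * s * (ε⁻¹) ^ j : ℝ) : ℂ) * I))
      (𝓝[>] 0) (𝓝 (Complex.exp (-(θ : ℂ) * I)))) {z : ℂ} (hz : 0 < z.re) :
    Tendsto (fun p : ℝ × ℂ => Complex.exp
      (-((w p.1 : ℂ) * I + ((p.1 ^ k : ℝ) : ℂ) * p.2) * (s : ℂ) * ((p.1⁻¹ : ℝ) : ℂ) ^ j))
      (𝓝[>] 0 ×ˢ 𝓝 z)
      (𝓝 (if j < k then Complex.exp (-(θ : ℂ) * I) else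
        if j = k then Complex.exp (-(s : ℂ) * z - (θ : ℂ) * I) else 0)) := by
  have hpos : ∀ᶠ p : ℝ × ℂ in 𝓝[>] 0 ×ˢ 𝓝 z, 0 < p.1 :=
    tendsto_fst.eventually self_mem_nhdsWithin
  have hsplit : ∀ p : ℝ × ℂ, Complex.exp
      (-((w p.1 : ℂ) * I + ((p.1 ^ k : ℝ) : ℂ) * p.2) * (s : ℂ) * ((p.1⁻¹ : ℝ) : ℂ) ^ j) =
      Complex.exp (-((w p.1 * s * (p.1⁻¹) ^ j : ℝ) : ℂ) * I) *
        Complex.exp (-p.2 * (s : ℂ) * ((p.1 ^ k * (p.1⁻¹) ^ j : ℝ) : ℂ)) := by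
    intro p
    rw [← Complex.exp_add]
    congr 1
    push_cast
    ring
  simp only [hsplit]
  have hcont : Continuous fun q : ℝ × ℂ => Complex.exp (-q.2 * (s : ℂ) * (q.1 : ℂ)) := by fun_prop
  rcases lt_trichotomy j k with h | rfl | h
  · rw [if_pos h]
    have h1 : Tendsto (fun p : ℝ × ℂ => ((p.1 ^ k * (p.1⁻¹) ^ j : ℝ), p.2))
        (𝓝[>] 0 ×ˢ 𝓝 z) (𝓝 (0, z)) := by
      refine Tendsto.prodMk_nhds ?_ tendsto_snd
      refine ((tendsto_pow_nhdsGT_zero (j := k - j) (by omega)).comp tendsto_fst).congr' ?_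
      filter_upwards [hpos] with p hp
      exact (pow_mul_inv_pow_of_le hp.ne' h.le).symm
    have h2 := ((hw h.le).comp tendsto_fst).mul ((hcont.tendsto (0, z)).comp h1)
    simpa using h2
  · rw [if_neg (lt_irrefl _), if_pos rfl]
    have h1 : Tendsto (fun p : ℝ × ℂ => ((p.1 ^ j * (p.1⁻¹) ^ j : ℝ), p.2))
        (𝓝[>] 0 ×ˢ 𝓝 z) (𝓝 (1, z)) := by
      refine Tendsto.prodMk_nhds ?_ tendsto_snd
      refine tendsto_const_nhds.congr' ?_
      filter_upwards [hpos] with p hp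
      simpa using (pow_mul_inv_pow_of_le hp.ne' (le_refl j)).symm
    have h2 := ((hw le_rfl).comp tendsto_fst).mul ((hcont.tendsto (1, z)).comp h1)
    have hval : Complex.exp (-(s : ℂ) * z - (θ : ℂ) * I) = Complex.exp (-(θ : ℂ) * I) *
        Complex.exp (-z * (s : ℂ) * ((1 : ℝ) : ℂ)) := by
      rw [← Complex.exp_add]
      congr 1
      push_cast
      ring
    rw [hval]
    exact h2
  · rw [if_neg h.not_gt, if_neg h.ne']
    have h1 := tendsto_exp_delay_zero hs (j := j - k) (by omega) hz
    rw [tendsto_zero_iff_norm_tendsto_zero] at h1 ⊢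
    refine h1.congr' ?_
    filter_upwards [hpos] with p hp
    rw [norm_mul, ← Complex.ofReal_neg, Complex.norm_exp_ofReal_mul_I, one_mul,
      pow_mul_inv_pow_of_ge hp.ne' h.le, Complex.ofReal_pow]

theorem eventually_chiFn_zero_of_chiTrunc (d n : ℕ)
    (A : ℕ → Matrix (Fin d) (Fin d) ℂ) (σ : ℕ → ℝ) (hσ : ∀ k, 1 ≤ k → k ≤ n → 0 < σ k)
    {k : ℕ} (hk : 1 ≤ k) (hkn : k ≤ n) {ω ψ γ : ℝ} {φ : ℕ → ℝ} (hγ : 0 < γ)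
    (hzero : chiTrunc d A σ k ω φ
      (Complex.exp (-((σ k * γ : ℝ) : ℂ) - (ψ : ℂ) * Complex.I)) = 0)
    (hne : ∃ Y : ℂ, chiTrunc d A σ k ω φ Y ≠ 0) :
    ∀ᶠ ε in 𝓝[>] (0 : ℝ), ∃ z : ℂ, 0 < z.re ∧ chiFn d n A σ ε z = 0 := by
  have hs : 0 < σ k := hσ k hk hkn
  set θ : ℕ → ℝ := fun j => if j = k then ψ else σ j * φ j with hθ
  obtain ⟨w, hw, hph⟩ := exists_frequency_tendsto σ θ ω k fun j h1 h2 => hσ j h1 (h2.trans hkn)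
  have hchi := differentiable_chiTrunc d A σ k ω φ
  have key := eventually_exists_zero_of_tendsto (l := 𝓝[>] (0 : ℝ)) (U := {z : ℂ | 0 < z.re})
    (z₀ := (γ : ℂ))
    (F := fun ε z => chiFn d n A σ ε ((w ε : ℂ) * I + ((ε ^ k : ℝ) : ℂ) * z))
    (G := fun z => chiTrunc d A σ k ω φ (Complex.exp (-(σ k : ℂ) * z - (ψ : ℂ) * I)))
    ((isOpen_lt continuous_const Complex.continuous_re).mem_nhds (by simpa using hγ))
    (fun ε => (differentiable_chiFn d n A σ ε).comp (by fun_prop))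
    (hchi.comp (by fun_prop))
    (by rw [← hzero]; push_cast; ring_nf)
    ?_ ?_
  · filter_upwards [key, self_mem_nhdsWithin] with ε ⟨z, hz, hFz⟩ hε
    refine ⟨_, ?_, hFz⟩
    have hεk : 0 < ε ^ k := pow_pos hε k
    rw [Complex.add_re, Complex.re_ofReal_mul, Complex.re_ofReal_mul, Complex.I_re, mul_zero,
      zero_add]
    exact mul_pos hεk hz
  · by_contra! h
    obtain ⟨Y, hY⟩ := hne
    have hext : chiTrunc d A σ k ω φ = fun _ => 0 := by
      refine hchi.continuous.ext_on (dense_compl_singleton (0 : ℂ)) continuous_const fun y hy => ?_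
      have hsc : (σ k : ℂ) ≠ 0 := Complex.ofReal_ne_zero.2 hs.ne'
      have h1 := h (-(Complex.log y + (ψ : ℂ) * I) / (σ k : ℂ))
      have h2 : -(σ k : ℂ) * (-(Complex.log y + (ψ : ℂ) * I) / (σ k : ℂ)) - (ψ : ℂ) * I =
          Complex.log y := by
        field_simp
        ring
      rwa [h2, Complex.exp_log hy] at h1
    exact hY (congrFun hext Y)
  · intro z hz
    have hlin : Tendsto (fun p : ℝ × ℂ => -((w p.1 : ℂ) * I + ((p.1 ^ k : ℝ) : ℂ) * p.2) •
        (1 : Matrix (Fin d) (Fin d) ℂ) + A 0) (𝓝[>] 0 ×ˢ 𝓝 z)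
        (𝓝 ((-(ω : ℂ) * I) • (1 : Matrix (Fin d) (Fin d) ℂ) + A 0)) := by
      refine Tendsto.add_const _ (Tendsto.smul_const ?_ _)
      have h1 : Tendsto (fun p : ℝ × ℂ => (w p.1 : ℂ)) (𝓝[>] 0 ×ˢ 𝓝 z) (𝓝 (ω : ℂ)) :=
        (Complex.continuous_ofReal.tendsto ω).comp (hw.comp tendsto_fst)
      have h2 : Tendsto (fun p : ℝ × ℂ => ((p.1 ^ k : ℝ) : ℂ)) (𝓝[>] 0 ×ˢ 𝓝 z)
          (𝓝 ((0 : ℝ) : ℂ)) :=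
        (Complex.continuous_ofReal.tendsto 0).comp
          ((tendsto_pow_nhdsGT_zero (by omega)).comp tendsto_fst)
      simpa using ((h1.mul_const I).add (h2.mul tendsto_snd)).neg
    have hsum := tendsto_finsetSum (Finset.Icc 1 n) fun j hj =>
      (tendsto_exp_delay_rescaled (hσ j (Finset.mem_Icc.1 hj).1 (Finset.mem_Icc.1 hj).2)
        (hph j (Finset.mem_Icc.1 hj).1) hz).smul_const (A j)
    have hval : (∑ j ∈ Finset.Icc 1 n, (if j < k then Complex.exp (-(θ j : ℂ) * I) else
        if j = k then Complex.exp (-(σ j : ℂ) * z - (θ j : ℂ) * I) else 0) • A j) =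
        ∑ j ∈ Finset.Icc 1 (k - 1), Complex.exp (-I * (σ j : ℂ) * (φ j : ℂ)) • A j +
          Complex.exp (-(σ k : ℂ) * z - (ψ : ℂ) * I) • A k := by
      obtain ⟨m, rfl⟩ : ∃ m, k = m + 1 := ⟨k - 1, by omega⟩
      rw [← Finset.sum_subset (Finset.Icc_subset_Icc_right hkn), Finset.sum_Icc_succ_top (by omega),
        Nat.add_sub_cancel]
      · congr 1
        · refine Finset.sum_congr rfl fun j hj => ?_
          rw [Finset.mem_Icc] at hj
          have hjm : j < m + 1 := by omega
          rw [if_pos hjm, hθ]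
          simp only [if_neg hjm.ne]
          congr 2
          push_cast
          ring
        · simp [hθ]
      · intro j hj hj'
        rw [Finset.mem_Icc] at hj hj'
        rw [if_neg (by omega), if_neg (by omega), zero_smul]
    have hdet := ((continuous_id.matrix_det).tendsto _).comp (hlin.add hsum)
    rw [hval, ← add_assoc] at hdet
    exact hdet

theorem stmt_8 (d n : ℕ) (hd : 1 ≤ d) (hn : 1 ≤ n)
    (A : ℕ → Matrix (Fin d) (Fin d) ℂ) (σ : ℕ → ℝ)
    (hσ : ∀ k, 1 ≤ k → k ≤ n → 0 < σ k)
    (hunst :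
      (∃ μ : ℂ, Matrix.det (-μ • (1 : Matrix (Fin d) (Fin d) ℂ) + A 0) = 0 ∧ 0 < μ.re) ∨
      (∃ k : ℕ, 1 ≤ k ∧ k ≤ n ∧ ∃ ω ψ γ : ℝ, ∃ φ : ℕ → ℝ, 0 < γ ∧
        chiTrunc d A σ k ω φ
          (Complex.exp (-((σ k * γ : ℝ) : ℂ) - (ψ : ℂ) * Complex.I)) = 0 ∧
        (∃ Y : ℂ, chiTrunc d A σ k ω φ Y ≠ 0))) :
    ∃ ε₀ > (0 : ℝ), ∀ ε : ℝ, 0 < ε → ε < ε₀ →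
      ∃ lam : ℂ, chiFn d n A σ ε lam = 0 ∧ 0 < lam.re := by
  have hev : ∀ᶠ ε in 𝓝[>] (0 : ℝ), ∃ z : ℂ, 0 < z.re ∧ chiFn d n A σ ε z = 0 := by
    rcases hunst with ⟨μ, hμ, hre⟩ | ⟨k, hk, hkn, ω, ψ, γ, φ, hγ, hzero, hne⟩
    · exact eventually_chiFn_zero_of_instantaneous d n A σ hσ hμ hre
    · exact eventually_chiFn_zero_of_chiTrunc d n A σ hσ hk hkn hγ hzero hne
  obtain ⟨ε₀, hε₀, h⟩ := mem_nhdsGT_iff_exists_Ioo_subset.1 hev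
  refine ⟨ε₀, hε₀, fun ε h1 h2 => ?_⟩
  obtain ⟨z, hz, hz0⟩ := h ⟨h1, h2⟩
  exact ⟨z, hz0, hz⟩
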